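/- arXiv:1503.07102 — 2 statements merged into one kernel-verified Lean document; each statement's English description precedes it below -/
import Mathlib

section
/- In the normal linear regression model y = Xβ + ε with ε ~ N_n(0, σ²V), let σ̂² = y^t P y / n with P = V^{−1} − V^{−1} X (X^t V^{−1} X)^{−1} X^t V^{−1}, and let A = V^{−1} − V^{−1} X (X^t V^{−1} X + W^{−1})^{−1} X^t V^{−1}. If n − p − 2 > 0, then E( y^t A y / σ̂² ) = n { tr(A V)/(n − p − 2) − 2 tr(A V P V)/((n − p)(n − p − 2)) + β^t X^t A X β / (σ²(n − p − 2)) }. -/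
open MeasureTheory Matrix Real Filter

/-- Density of the `n`-variate normal distribution with mean vector `μ` and
covariance matrix `S`, with respect to the Lebesgue measure on `Fin n → ℝ`. -/
noncomputable def gaussPdf {n : ℕ} (μ : Fin n → ℝ) (S : Matrix (Fin n) (Fin n) ℝ)
    (x : Fin n → ℝ) : ℝ :=
  ((2 * π) ^ n * S.det) ^ (-(1 : ℝ) / 2) *
    Real.exp (-((x - μ) ⬝ᵥ S⁻¹.mulVec (x - μ)) / 2)

theorem integrable_sq_mul_exp_neg_mul_sq {b : ℝ} (hb : 0 < b) :
    Integrable (fun x : ℝ => x ^ 2 * exp (-b * x ^ 2)) := by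
  simpa using integrable_rpow_mul_exp_neg_mul_sq hb (s := 2) (by norm_num)

theorem integral_sq_mul_exp_neg_mul_sq {b : ℝ} (hb : 0 < b) :
    ∫ x : ℝ, x ^ 2 * exp (-b * x ^ 2) = (2 * b)⁻¹ * ∫ x : ℝ, exp (-b * x ^ 2) := by
  have h0 := integrable_exp_neg_mul_sq hb
  have h2 := (integrable_sq_mul_exp_neg_mul_sq hb).const_mul (2 * b)
  have h := integral_eq_zero_of_hasDerivAt_of_integrable
    (f := fun x : ℝ => x * exp (-b * x ^ 2))
    (f' := fun x : ℝ => exp (-b * x ^ 2) - 2 * b * (x ^ 2 * exp (-b * x ^ 2)))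
    (fun x => by
      have h1 := (hasDerivAt_id x).mul (((hasDerivAt_id x).pow 2).const_mul (-b)).exp
      convert! h1 using 1
      simp
      ring)
    (h0.sub h2) (integrable_mul_exp_neg_mul_sq hb)
  rw [integral_sub h0 h2, integral_const_mul] at h
  rw [eq_inv_mul_iff_mul_eq₀ (by positivity)]
  linarith

section

variable {ι : Type*} [Fintype ι]

/-- The unnormalized density `exp (-|z|² / 2)` of the standard normal distribution on `ι → ℝ`. -/
noncomputable def stdGaussKernel (z : ι → ℝ) : ℝ := exp (-(∑ j, z j ^ 2) / 2)

theorem stdGaussKernel_pos (z : ι → ℝ) : 0 < stdGaussKernel z := exp_pos _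

theorem continuous_stdGaussKernel : Continuous (stdGaussKernel (ι := ι)) := by
  unfold stdGaussKernel
  fun_prop

theorem integrable_and_integral_tilted (d : ι → ℝ) (t : ℝ) (i : ι) (h : ℝ → ℝ) (κ : ℝ)
    (hd : ∀ j, 0 < 1 + 2 * t * d j)
    (hi : Integrable (fun x : ℝ => h x * exp (-((1 + 2 * t * d i) / 2) * x ^ 2)))
    (hκ : ∫ x : ℝ, h x * exp (-((1 + 2 * t * d i) / 2) * x ^ 2)
      = κ * ∫ x : ℝ, exp (-((1 + 2 * t * d i) / 2) * x ^ 2)) :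
    Integrable (fun z : ι → ℝ =>
        h (z i) * exp (-(∑ j, d j * z j ^ 2) * t) * stdGaussKernel z) ∧
      ∫ z : ι → ℝ, h (z i) * exp (-(∑ j, d j * z j ^ 2) * t) * stdGaussKernel z
        = κ * ∏ j, √(2 * π / (1 + 2 * t * d j)) := by
  classical
  let f : ι → ℝ → ℝ := fun j x =>
    (if j = i then h x else 1) * exp (-((1 + 2 * t * d j) / 2) * x ^ 2)
  have hf : (fun z : ι → ℝ => h (z i) * exp (-(∑ j, d j * z j ^ 2) * t) * stdGaussKernel z)
      = fun z => ∏ j, f j (z j) := by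
    ext z
    simp only [f, Finset.prod_mul_distrib, Finset.prod_ite_eq', Finset.mem_univ, if_true,
      stdGaussKernel, mul_assoc, ← Real.exp_add, ← Real.exp_sum]
    congr 2
    rw [neg_mul, neg_div, Finset.sum_mul, Finset.sum_div, ← neg_add, ← Finset.sum_add_distrib,
      ← Finset.sum_neg_distrib]
    refine Finset.sum_congr rfl fun j _ => ?_
    ring
  have hfi : ∀ j, Integrable (f j) := by
    intro j
    by_cases hj : j = i
    · subst hj
      simpa [f] using hi
    · simpa [f, hj] using integrable_exp_neg_mul_sq (half_pos (hd j))
  have hfint : ∀ j, ∫ x, f j x = (if j = i then κ else 1) * √(2 * π / (1 + 2 * t * d j)) := by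
    intro j
    have hg : √(2 * π / (1 + 2 * t * d j)) = ∫ x : ℝ, exp (-((1 + 2 * t * d j) / 2) * x ^ 2) := by
      rw [integral_gaussian]
      congr 1
      have := (hd j).ne'
      field_simp
    rw [hg]
    by_cases hj : j = i
    · subst hj
      simpa [f] using hκ
    · simp [f, hj]
  rw [hf]
  refine ⟨Integrable.fintype_prod hfi, ?_⟩
  rw [integral_fintype_prod_volume_eq_prod]
  simp_rw [hfint, Finset.prod_mul_distrib]
  simp

theorem integrable_and_integral_div_of_tilted (d : ι → ℝ) (hd : ∀ j, 0 ≤ d j)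
    (h : (ι → ℝ) → ℝ) (hc : Continuous h) (hh : ∀ z, 0 ≤ h z) (F : ℝ → ℝ)
    (hF : ∀ t > 0, Integrable (fun z : ι → ℝ =>
        h z * exp (-(∑ j, d j * z j ^ 2) * t) * stdGaussKernel z) ∧
      ∫ z : ι → ℝ, h z * exp (-(∑ j, d j * z j ^ 2) * t) * stdGaussKernel z = F t)
    (hFi : IntegrableOn F (Set.Ioi 0)) :
    Integrable (fun z : ι → ℝ => h z / (∑ j, d j * z j ^ 2) * stdGaussKernel z) ∧
      ∫ z : ι → ℝ, h z / (∑ j, d j * z j ^ 2) * stdGaussKernel z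
        = ∫ t in Set.Ioi 0, F t := by
  have hker := continuous_stdGaussKernel (ι := ι)
  let G : (ι → ℝ) → ℝ → ℝ := fun z t =>
    h z * exp (-(∑ j, d j * z j ^ 2) * t) * stdGaussKernel z
  have hGc : Continuous (Function.uncurry G) := by
    simp only [G, Function.uncurry_def]
    fun_prop
  have hG0 : ∀ z t, 0 ≤ G z t := fun z t =>
    mul_nonneg (mul_nonneg (hh z) (exp_pos _).le) (stdGaussKernel_pos z).le
  have hGi : Integrable (Function.uncurry G)
      (volume.prod (volume.restrict (Set.Ioi (0 : ℝ)))) := by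
    rw [integrable_prod_iff' hGc.aestronglyMeasurable]
    constructor
    · filter_upwards [ae_restrict_mem measurableSet_Ioi] with t ht
      exact (hF t ht).1
    · refine hFi.congr ?_
      filter_upwards [ae_restrict_mem measurableSet_Ioi] with t ht
      simp only [Function.uncurry, Real.norm_of_nonneg (hG0 _ _)]
      exact (hF t ht).2.symm
  have hGt : ∀ z, ∫ t in Set.Ioi (0 : ℝ), G z t
      = h z / (∑ j, d j * z j ^ 2) * stdGaussKernel z := by
    intro z
    have hq : 0 ≤ ∑ j, d j * z j ^ 2 := Finset.sum_nonneg fun j _ => mul_nonneg (hd j) (sq_nonneg _)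
    simp only [G]
    rw [integral_mul_const, integral_const_mul]
    congr 1
    rcases hq.eq_or_lt with h0 | h0
    · simp [← h0, Measure.real]
    · rw [integral_exp_mul_Ioi (neg_lt_zero.mpr h0)]
      simp [div_eq_mul_inv]
  constructor
  · have := hGi.integral_prod_left
    simpa only [Function.uncurry, hGt] using this
  · simp_rw [← hGt]
    rw [integral_integral_swap hGi]
    exact setIntegral_congr_fun measurableSet_Ioi fun t ht => (hF t ht).2

theorem integrableOn_and_integral_Ioi_one_add_two_mul_rpow {a : ℝ} (ha : 0 < a) :
    IntegrableOn (fun t : ℝ => (1 + 2 * t) ^ (-a / 2 - 1)) (Set.Ioi 0) ∧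
      ∫ t in Set.Ioi (0 : ℝ), (1 + 2 * t) ^ (-a / 2 - 1) = a⁻¹ := by
  have hderiv : ∀ t ∈ Set.Ici (0 : ℝ),
      HasDerivAt (fun t : ℝ => -a⁻¹ * (1 + 2 * t) ^ (-a / 2)) ((1 + 2 * t) ^ (-a / 2 - 1)) t := by
    intro t ht
    have ht' : (0 : ℝ) ≤ t := ht
    have h1 : HasDerivAt (fun t : ℝ => 1 + 2 * t) 2 t := by
      simpa using ((hasDerivAt_id t).const_mul 2).const_add 1
    have h2 := (h1.rpow_const (p := -a / 2) (Or.inl (by positivity))).const_mul (-a⁻¹)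
    convert! h2 using 1
    field_simp
  have hpos : ∀ t ∈ Set.Ioi (0 : ℝ), 0 ≤ (1 + 2 * t) ^ (-a / 2 - 1) := by
    intro t ht
    have ht' : (0 : ℝ) < t := ht
    positivity
  have hlim : Tendsto (fun t : ℝ => -a⁻¹ * (1 + 2 * t) ^ (-a / 2)) atTop (nhds 0) := by
    have h1 : Tendsto (fun t : ℝ => 1 + 2 * t) atTop atTop :=
      tendsto_atTop_add_const_left _ _ (tendsto_id.const_mul_atTop (by norm_num))
    have h2 := ((tendsto_rpow_neg_atTop (half_pos ha)).comp h1).const_mul (-a⁻¹)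
    simpa [Function.comp_def, neg_div] using h2
  refine ⟨integrableOn_Ioi_deriv_of_nonneg' hderiv hpos hlim, ?_⟩
  rw [integral_Ioi_of_hasDerivAt_of_nonneg' hderiv hpos hlim]
  simp

theorem prod_sqrt_div_one_add_two_mul (d : ι → ℝ) (hd : ∀ j, d j = 0 ∨ d j = 1) {t : ℝ}
    (ht : 0 < t) :
    ∏ j, √(2 * π / (1 + 2 * t * d j))
      = √(2 * π) ^ Fintype.card ι * (1 + 2 * t) ^ (-(∑ j, d j) / 2) := by
  have h : ∀ j, √(2 * π / (1 + 2 * t * d j)) = √(2 * π) * (1 + 2 * t) ^ (-d j / 2) := by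
    intro j
    rcases hd j with h | h
    · simp [h]
    · rw [h, mul_one, Real.sqrt_div (by positivity), neg_div, Real.rpow_neg (by positivity),
        Real.sqrt_eq_rpow (1 + 2 * t), div_eq_mul_inv]
  simp_rw [h, Finset.prod_mul_distrib]
  rw [← Real.rpow_sum_of_pos (by positivity), ← Finset.sum_div, Finset.sum_neg_distrib]
  simp

theorem integrable_and_integral_inv_sum_sq (d : ι → ℝ) (hd : ∀ j, d j = 0 ∨ d j = 1) {m : ℝ}
    (hm : ∑ j, d j = m) (h2 : 2 < m) :
    Integrable (fun z : ι → ℝ => 1 / (∑ j, d j * z j ^ 2) * stdGaussKernel z) ∧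
      ∫ z : ι → ℝ, 1 / (∑ j, d j * z j ^ 2) * stdGaussKernel z
        = √(2 * π) ^ Fintype.card ι * (m - 2)⁻¹ := by
  have hd0 : ∀ j, 0 ≤ d j := fun j => by rcases hd j with h | h <;> simp [h]
  obtain ⟨i⟩ : Nonempty ι := by
    by_contra hne
    rw [not_nonempty_iff] at hne
    simp at hm
    linarith
  have hI := integrableOn_and_integral_Ioi_one_add_two_mul_rpow (sub_pos.mpr h2)
  have he : -(m - 2) / 2 - 1 = -m / 2 := by ring
  rw [he] at hI
  have key := integrable_and_integral_div_of_tilted d hd0 (fun _ => 1) continuous_const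
    (fun _ => zero_le_one) (fun t => √(2 * π) ^ Fintype.card ι * (1 + 2 * t) ^ (-m / 2))
    (fun t ht => by
      have hpos : ∀ j, 0 < 1 + 2 * t * d j := fun j => by
        have := hd0 j
        have ht' : 0 < t := ht
        positivity
      have := integrable_and_integral_tilted d t i (fun _ => 1) 1 hpos
        (by simpa using integrable_exp_neg_mul_sq (half_pos (hpos i))) (by simp)
      rwa [prod_sqrt_div_one_add_two_mul d hd ht, hm, one_mul] at this)
    (hI.1.const_mul _)
  rwa [integral_const_mul, hI.2] at key

theorem integrable_and_integral_sq_div_sum_sq (d : ι → ℝ) (hd : ∀ j, d j = 0 ∨ d j = 1) {m : ℝ}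
    (hm : ∑ j, d j = m) (h2 : 2 < m) (i : ι) :
    Integrable (fun z : ι → ℝ => z i ^ 2 / (∑ j, d j * z j ^ 2) * stdGaussKernel z) ∧
      ∫ z : ι → ℝ, z i ^ 2 / (∑ j, d j * z j ^ 2) * stdGaussKernel z
        = √(2 * π) ^ Fintype.card ι * (m - 2 + 2 * d i)⁻¹ := by
  have hd0 : ∀ j, 0 ≤ d j := fun j => by rcases hd j with h | h <;> simp [h]
  have hI := integrableOn_and_integral_Ioi_one_add_two_mul_rpow
    (a := m - 2 + 2 * d i) (by linarith [hd0 i])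
  have he : -(m - 2 + 2 * d i) / 2 - 1 = -m / 2 - d i := by ring
  rw [he] at hI
  have key := integrable_and_integral_div_of_tilted d hd0 (fun z => z i ^ 2) (by fun_prop)
    (fun z => sq_nonneg _)
    (fun t => √(2 * π) ^ Fintype.card ι * (1 + 2 * t) ^ (-m / 2 - d i))
    (fun t ht => by
      have ht' : 0 < t := ht
      have hpos : ∀ j, 0 < 1 + 2 * t * d j := fun j => by
        have := hd0 j
        positivity
      have hb := half_pos (hpos i)
      have := integrable_and_integral_tilted d t i (fun x => x ^ 2) (1 + 2 * t * d i)⁻¹ hpos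
        (integrable_sq_mul_exp_neg_mul_sq hb)
        (by rw [integral_sq_mul_exp_neg_mul_sq hb, mul_div_cancel₀ _ (two_ne_zero' ℝ)])
      rw [prod_sqrt_div_one_add_two_mul d hd ht, hm] at this
      refine ⟨this.1, this.2.trans ?_⟩
      have hpow : (1 + 2 * t * d i)⁻¹ = (1 + 2 * t) ^ (-d i) := by
        rcases hd i with h | h
        · simp [h]
        · rw [h, Real.rpow_neg_one, mul_one]
      rw [hpow, mul_left_comm, ← Real.rpow_add (by positivity)]
      ring_nf)
    (hI.1.const_mul _)
  rwa [integral_const_mul, hI.2] at key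

/-- Reflection of the `i`-th coordinate preserves Lebesgue measure, so odd functions
integrate to zero. -/
theorem integral_eq_zero_of_odd_coord [DecidableEq ι] (i : ι) (f : (ι → ℝ) → ℝ)
    (hf : ∀ z, f (Function.update z i (-z i)) = -f z) : ∫ z, f z = 0 := by
  let e : ∀ j : ι, ℝ ≃ᵐ ℝ := fun j => if j = i then MeasurableEquiv.neg ℝ else MeasurableEquiv.refl ℝ
  have he : MeasurePreserving (MeasurableEquiv.piCongrRight e) (volume : Measure (ι → ℝ)) volume := by
    refine volume_preserving_pi (f := fun j => e j) fun j => ?_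
    by_cases hj : j = i
    · simpa [e, hj] using Measure.measurePreserving_neg (volume : Measure ℝ)
    · simp only [e, hj, if_false]
      exact MeasurePreserving.id (volume : Measure ℝ)
  have h := he.integral_comp' f
  have hz : ∀ z, MeasurableEquiv.piCongrRight e z = Function.update z i (-z i) := by
    intro z
    ext j
    change e j (z j) = _
    by_cases hj : j = i
    · subst hj
      simp [e]
    · simp [e, hj]
  simp_rw [hz, hf, integral_neg] at h
  linarith

theorem integral_quadratic_div_sum_sq [DecidableEq ι] (d : ι → ℝ)
    (hd : ∀ j, d j = 0 ∨ d j = 1) {m : ℝ} (hm : ∑ j, d j = m) (h2 : 2 < m)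
    (c : ℝ) (l : ι → ℝ) (C : Matrix ι ι ℝ) :
    ∫ z : ι → ℝ, (c + l ⬝ᵥ z + z ⬝ᵥ C *ᵥ z) / (∑ j, d j * z j ^ 2) * stdGaussKernel z
      = √(2 * π) ^ Fintype.card ι * (c * (m - 2)⁻¹ + ∑ i, C i i * (m - 2 + 2 * d i)⁻¹) := by
  let q : (ι → ℝ) → ℝ := fun z => ∑ j, d j * z j ^ 2
  have hker := (continuous_stdGaussKernel (ι := ι)).measurable
  have hqm : Measurable q := by fun_prop
  have hq0 : ∀ z, 0 ≤ q z := fun z => Finset.sum_nonneg fun j _ => by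
    rcases hd j with h | h <;> rw [h] <;> positivity
  have hone : Integrable (fun z => 1 / q z * stdGaussKernel z) ∧
      ∫ z, 1 / q z * stdGaussKernel z = √(2 * π) ^ Fintype.card ι * (m - 2)⁻¹ :=
    integrable_and_integral_inv_sum_sq d hd hm h2
  have hsq : ∀ i, Integrable (fun z => z i ^ 2 / q z * stdGaussKernel z) ∧
      ∫ z, z i ^ 2 / q z * stdGaussKernel z
        = √(2 * π) ^ Fintype.card ι * (m - 2 + 2 * d i)⁻¹ :=
    integrable_and_integral_sq_div_sum_sq d hd hm h2
  have hmono : ∀ (f g : (ι → ℝ) → ℝ), Measurable f → (∀ z, |f z| ≤ g z) →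
      Integrable (fun z => g z / q z * stdGaussKernel z) →
      Integrable (fun z => f z / q z * stdGaussKernel z) := by
    intro f g hf hfg hg
    refine hg.mono' (by fun_prop) (ae_of_all _ fun z => ?_)
    rw [Real.norm_eq_abs, abs_mul, abs_div, abs_of_nonneg (hq0 z),
      abs_of_pos (stdGaussKernel_pos z)]
    gcongr
    · exact (stdGaussKernel_pos z).le
    · exact hq0 z
    · exact hfg z
  have hlin : ∀ i, Integrable (fun z : ι → ℝ => z i / q z * stdGaussKernel z) := by
    intro i
    refine hmono _ (fun z => 1 + z i ^ 2) (by fun_prop) (fun z => ?_) ?_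
    · rw [abs_le]
      constructor <;> nlinarith [sq_nonneg (z i + 1), sq_nonneg (z i - 1)]
    · simp only [add_div, add_mul]
      exact hone.1.add (hsq i).1
  have hquad : ∀ i j, Integrable (fun z : ι → ℝ => z i * z j / q z * stdGaussKernel z) := by
    intro i j
    refine hmono _ (fun z => z i ^ 2 + z j ^ 2) (by fun_prop) (fun z => ?_) ?_
    · rw [abs_le]
      constructor <;> nlinarith [sq_nonneg (z i + z j), sq_nonneg (z i - z j)]
    · simp only [add_div, add_mul]
      exact (hsq i).1.add (hsq j).1
  have hinv : ∀ (i : ι) (z : ι → ℝ), q (Function.update z i (-z i)) = q z ∧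
      stdGaussKernel (Function.update z i (-z i)) = stdGaussKernel z := by
    intro i z
    have h : ∀ j, Function.update z i (-z i) j ^ 2 = z j ^ 2 := by
      intro j
      by_cases hj : j = i
      · subst hj
        simp
      · simp [hj]
    simp [q, stdGaussKernel, h]
  have hlin0 : ∀ i, ∫ z : ι → ℝ, z i / q z * stdGaussKernel z = 0 := by
    intro i
    refine integral_eq_zero_of_odd_coord i _ fun z => ?_
    rw [(hinv i z).1, (hinv i z).2, Function.update_self]
    ring
  have hquad0 : ∀ i j, ∫ z : ι → ℝ, z i * z j / q z * stdGaussKernel z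
      = if i = j then √(2 * π) ^ Fintype.card ι * (m - 2 + 2 * d i)⁻¹ else 0 := by
    intro i j
    split_ifs with hij
    · subst hij
      simpa only [← sq] using (hsq i).2
    · refine integral_eq_zero_of_odd_coord i _ fun z => ?_
      rw [(hinv i z).1, (hinv i z).2, Function.update_self,
        Function.update_of_ne (Ne.symm hij)]
      ring
  have hexp : ∀ z : ι → ℝ, (c + l ⬝ᵥ z + z ⬝ᵥ C *ᵥ z) / (∑ j, d j * z j ^ 2) * stdGaussKernel z
      = c * (1 / q z * stdGaussKernel z) + ∑ i, l i * (z i / q z * stdGaussKernel z)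
        + ∑ i, ∑ j, C i j * (z i * z j / q z * stdGaussKernel z) := by
    intro z
    have e1 : ∑ i, l i * (z i / q z * stdGaussKernel z) = l ⬝ᵥ z / q z * stdGaussKernel z := by
      simp only [dotProduct, Finset.sum_div, Finset.sum_mul]
      exact Finset.sum_congr rfl fun i _ => by ring
    have e2 : ∑ i, ∑ j, C i j * (z i * z j / q z * stdGaussKernel z)
        = z ⬝ᵥ C *ᵥ z / q z * stdGaussKernel z := by
      simp only [dotProduct, mulVec, Finset.mul_sum, Finset.sum_div, Finset.sum_mul]
      exact Finset.sum_congr rfl fun i _ => Finset.sum_congr rfl fun j _ => by ring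
    rw [e1, e2]
    simp only [q]
    ring
  have i1 := hone.1.const_mul c
  have i2 : Integrable (fun z : ι → ℝ => ∑ i, l i * (z i / q z * stdGaussKernel z)) :=
    integrable_finsetSum _ fun i _ => (hlin i).const_mul _
  have i3 : ∀ i, Integrable (fun z : ι → ℝ => ∑ j, C i j * (z i * z j / q z * stdGaussKernel z)) :=
    fun i => integrable_finsetSum _ fun j _ => (hquad i j).const_mul _
  have i12 : Integrable (fun z : ι → ℝ => c * (1 / q z * stdGaussKernel z)
      + ∑ i, l i * (z i / q z * stdGaussKernel z)) := i1.add i2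
  have i33 : Integrable (fun z : ι → ℝ =>
      ∑ i, ∑ j, C i j * (z i * z j / q z * stdGaussKernel z)) :=
    integrable_finsetSum _ fun i _ => i3 i
  simp_rw [hexp]
  rw [integral_add i12 i33, integral_add i1 i2,
    integral_const_mul, hone.2, integral_finsetSum _ fun i _ => (hlin i).const_mul _,
    integral_finsetSum _ fun i _ => i3 i]
  have e3 : ∀ i, ∫ z : ι → ℝ, ∑ j, C i j * (z i * z j / q z * stdGaussKernel z)
      = C i i * (√(2 * π) ^ Fintype.card ι * (m - 2 + 2 * d i)⁻¹) := by
    intro i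
    rw [integral_finsetSum _ fun j _ => (hquad i j).const_mul _]
    simp [integral_const_mul, hquad0]
  simp_rw [e3, integral_const_mul, hlin0]
  simp only [mul_zero, Finset.sum_const_zero, add_zero, mul_add, Finset.mul_sum]
  congr 1
  · ring
  · exact Finset.sum_congr rfl fun i _ => by ring

end

theorem mulVec_injective_of_rank_eq {n p : ℕ} {X : Matrix (Fin n) (Fin p) ℝ} (hX : X.rank = p) :
    Function.Injective X.mulVec := by
  rw [Matrix.mulVec_injective_iff, linearIndependent_iff_card_eq_finrank_span, Set.finrank,
    ← Matrix.rank_eq_finrank_span_cols, hX, Fintype.card_fin]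

open scoped MatrixOrder in
/-- A positive definite `V` factors as `L * Lᵀ`, where `L` may be chosen so that it also
diagonalizes a symmetric `P` with `P * V * P = P`; the diagonal entries are then `0` or `1`. -/
theorem exists_factor_diagonal {n : ℕ} {V P : Matrix (Fin n) (Fin n) ℝ} (hV : V.PosDef)
    (hPs : Pᵀ = P) (hPVP : P * V * P = P) :
    ∃ (L : Matrix (Fin n) (Fin n) ℝ) (d : Fin n → ℝ), L * Lᵀ = V ∧ Lᵀ * P * L = diagonal d ∧
      ∀ j, d j = 0 ∨ d j = 1 := by
  obtain ⟨S, hS⟩ := CStarAlgebra.nonneg_iff_eq_star_mul_self.mp hV.posSemidef.nonneg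
  rw [star_eq_conjTranspose, conjTranspose_eq_transpose_of_trivial] at hS
  have hM : (S * P * Sᵀ).IsHermitian := by
    rw [IsHermitian, conjTranspose_eq_transpose_of_trivial]
    simp [transpose_mul, hPs, Matrix.mul_assoc]
  let U : Matrix (Fin n) (Fin n) ℝ := hM.eigenvectorUnitary
  have hU1 : Uᵀ * U = 1 := by
    have := Unitary.coe_star_mul_self hM.eigenvectorUnitary
    rwa [star_eq_conjTranspose, conjTranspose_eq_transpose_of_trivial] at this
  have hU2 : U * Uᵀ = 1 := mul_eq_one_comm.mp hU1
  have hspec : S * P * Sᵀ = U * diagonal hM.eigenvalues * Uᵀ := by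
    have := hM.spectral_theorem
    rw [Unitary.conjStarAlgAut_apply, star_eq_conjTranspose,
      conjTranspose_eq_transpose_of_trivial] at this
    exact this
  have hdiag : Uᵀ * (S * P * Sᵀ) * U = diagonal hM.eigenvalues := by
    calc _ = Uᵀ * (U * diagonal hM.eigenvalues * Uᵀ) * U := congrArg (fun M => Uᵀ * M * U) hspec
      _ = (Uᵀ * U) * diagonal hM.eigenvalues * (Uᵀ * U) := by simp only [Matrix.mul_assoc]
      _ = _ := by simp [hU1]
  have hidem : diagonal hM.eigenvalues * diagonal hM.eigenvalues = diagonal hM.eigenvalues := by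
    rw [← hdiag]
    calc _ = Uᵀ * (S * P * Sᵀ) * (U * Uᵀ) * (S * P * Sᵀ) * U := by simp only [Matrix.mul_assoc]
      _ = Uᵀ * (S * (P * (Sᵀ * S) * P) * Sᵀ) * U := by
        rw [hU2]
        simp only [Matrix.mul_assoc, Matrix.one_mul]
      _ = _ := by rw [← hS, hPVP]
  refine ⟨Sᵀ * U, hM.eigenvalues, ?_, ?_, fun j => ?_⟩
  · calc _ = Sᵀ * (U * Uᵀ) * S := by simp only [transpose_mul, transpose_transpose, Matrix.mul_assoc]
      _ = V := by rw [hU2, Matrix.mul_one, hS]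
  · rw [← hdiag]
    simp only [transpose_mul, transpose_transpose, Matrix.mul_assoc]
  · rw [diagonal_mul_diagonal] at hidem
    have := congrFun (diagonal_injective hidem) j
    have h0 : hM.eigenvalues j * (hM.eigenvalues j - 1) = 0 := by linarith
    rcases mul_eq_zero.mp h0 with h | h
    · exact Or.inl h
    · exact Or.inr (by linarith)

theorem residual_matrix_properties {n p : ℕ} {X : Matrix (Fin n) (Fin p) ℝ} (hX : X.rank = p)
    {V P : Matrix (Fin n) (Fin n) ℝ} (hV : V.PosDef)
    (hP : P = V⁻¹ - V⁻¹ * X * (Xᵀ * V⁻¹ * X)⁻¹ * Xᵀ * V⁻¹) :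
    Pᵀ = P ∧ P * X = 0 ∧ P * V * P = P ∧ (P * V).trace = (n : ℝ) - p := by
  have hG : (Xᵀ * V⁻¹ * X).PosDef := by
    have := hV.inv.conjTranspose_mul_mul_same (mulVec_injective_of_rank_eq hX)
    rwa [conjTranspose_eq_transpose_of_trivial] at this
  have hVu : IsUnit V.det := (isUnit_iff_isUnit_det V).mp hV.isUnit
  have hGu : IsUnit (Xᵀ * V⁻¹ * X).det := (isUnit_iff_isUnit_det _).mp hG.isUnit
  have hVt : Vᵀ = V := by
    rw [← conjTranspose_eq_transpose_of_trivial]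
    exact hV.isHermitian
  have hVit : (V⁻¹)ᵀ = V⁻¹ := by rw [transpose_nonsing_inv, hVt]
  set G := Xᵀ * V⁻¹ * X with hGdef
  have hGt : Gᵀ = G := by simp [hGdef, transpose_mul, hVit, Matrix.mul_assoc]
  have hGit : (G⁻¹)ᵀ = G⁻¹ := by rw [transpose_nonsing_inv, hGt]
  have hPt : Pᵀ = P := by
    simp [hP, transpose_mul, hVit, hGit, Matrix.mul_assoc]
  have hPX : P * X = 0 := by
    have h : V⁻¹ * X * G⁻¹ * Xᵀ * V⁻¹ * X = V⁻¹ * X := by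
      calc _ = V⁻¹ * X * (G⁻¹ * G) := by simp only [hGdef, Matrix.mul_assoc]
        _ = _ := by rw [nonsing_inv_mul _ hGu, Matrix.mul_one]
    rw [hP, Matrix.sub_mul, h, sub_self]
  have hPV : P * V = 1 - V⁻¹ * X * G⁻¹ * Xᵀ := by
    rw [hP, Matrix.sub_mul, Matrix.mul_assoc _ V⁻¹ V, nonsing_inv_mul _ hVu, Matrix.mul_one]
  have hXP : Xᵀ * P = 0 := by
    rw [← hPt, ← transpose_mul, hPX, transpose_zero]
  refine ⟨hPt, hPX, ?_, ?_⟩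
  · rw [hPV, Matrix.sub_mul, Matrix.one_mul, Matrix.mul_assoc _ Xᵀ P, hXP, Matrix.mul_zero,
      sub_zero]
  · rw [hPV, trace_sub, Matrix.mul_assoc, trace_mul_comm, Matrix.mul_assoc,
      ← Matrix.mul_assoc Xᵀ, nonsing_inv_mul _ hGu]
    simp

theorem integral_comp_affine {n : ℕ} (μ : Fin n → ℝ) {T : Matrix (Fin n) (Fin n) ℝ}
    (hT : T.det ≠ 0) (g : (Fin n → ℝ) → ℝ) :
    ∫ y, g y = |T.det| * ∫ z, g (μ + T *ᵥ z) := by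
  have hTu : IsUnit T := (isUnit_iff_isUnit_det T).mpr (isUnit_iff_ne_zero.mpr hT)
  let T' : (Fin n → ℝ) →L[ℝ] (Fin n → ℝ) := LinearMap.toContinuousLinearMap (toLin' T)
  have hdet : T'.det = T.det := by
    simp [T', ContinuousLinearMap.det]
  have hinj : Function.Injective fun z => μ + T *ᵥ z := fun a b h =>
    mulVec_injective_of_isUnit hTu (add_left_cancel h)
  have hsurj : Function.Surjective fun z => μ + T *ᵥ z := fun y => by
    obtain ⟨z, hz⟩ := (mulVec_surjective_iff_isUnit.mpr hTu) (y - μ)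
    exact ⟨z, by simp [hz]⟩
  have h := integral_image_eq_integral_abs_det_fderiv_smul volume MeasurableSet.univ
    (f := fun z => μ + T *ᵥ z) (f' := fun _ => T')
    (fun z _ => (T'.hasFDerivAt.const_add μ).hasFDerivWithinAt) hinj.injOn g
  rw [Set.image_univ, hsurj.range_eq, setIntegral_univ, setIntegral_univ] at h
  rw [h, hdet]
  simp [integral_const_mul]

theorem abs_det_mul_gaussPdf {n : ℕ} (μ : Fin n → ℝ) {V L : Matrix (Fin n) (Fin n) ℝ}
    (hV : V.PosDef) (hL : L * Lᵀ = V) {s : ℝ} (hs : 0 < s) (z : Fin n → ℝ) :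
    |(s • L).det| * gaussPdf μ (s ^ 2 • V) (μ + (s • L) *ᵥ z)
      = (√(2 * π) ^ n)⁻¹ * stdGaussKernel z := by
  have hTT : s ^ 2 • V = (s • L) * (s • L)ᵀ := by
    rw [← hL, transpose_smul, smul_mul_smul_comm, sq]
  have hdet : (s ^ 2 • V).det = (s • L).det ^ 2 := by
    rw [hTT, det_mul, det_transpose, sq]
  have hpos : 0 < (s ^ 2 • V).det := (hV.smul (by positivity : 0 < s ^ 2)).det_pos
  set T := s • L with hTdef
  have hT : T.det ≠ 0 := by
    intro h
    rw [hdet, h] at hpos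
    simp at hpos
  have hTu : IsUnit T.det := isUnit_iff_ne_zero.mpr hT
  have hTtu : IsUnit Tᵀ.det := by rwa [det_transpose]
  have hquad : (T *ᵥ z) ⬝ᵥ (s ^ 2 • V)⁻¹ *ᵥ (T *ᵥ z) = ∑ j, z j ^ 2 := by
    have h1 : Tᵀ * ((s ^ 2 • V)⁻¹ * T) = 1 := by
      rw [hTT, Matrix.mul_inv_rev, Matrix.mul_assoc, nonsing_inv_mul _ hTu, Matrix.mul_one,
        mul_nonsing_inv _ hTtu]
    rw [mulVec_mulVec, ← vecMul_transpose T z, ← dotProduct_mulVec, mulVec_mulVec, h1, one_mulVec]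
    simp [dotProduct, sq]
  have hconst : |T.det| * ((2 * π) ^ n * (s ^ 2 • V).det) ^ (-(1 : ℝ) / 2)
      = (√(2 * π) ^ n)⁻¹ := by
    rw [hdet, neg_div, Real.rpow_neg (by positivity), ← Real.sqrt_eq_rpow,
      Real.sqrt_mul (by positivity), Real.sqrt_sq_eq_abs]
    have h2 : √((2 * π) ^ n) = √(2 * π) ^ n := by
      rw [Real.sqrt_eq_iff_mul_self_eq (by positivity) (by positivity), ← mul_pow,
        Real.mul_self_sqrt (by positivity)]
    have := abs_pos.mpr hT
    rw [h2]
    field_simp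
  rw [gaussPdf, ← mul_assoc, hconst, add_sub_cancel_left, hquad, stdGaussKernel]

/-- In the model `y ~ N_n(Xβ, σ²V)` with `σ̂² = yᵀPy/n`,
`P = V⁻¹ - V⁻¹X(XᵀV⁻¹X)⁻¹XᵀV⁻¹` and
`A = V⁻¹ - V⁻¹X(XᵀV⁻¹X + W⁻¹)⁻¹XᵀV⁻¹`, if `n - p - 2 > 0` then
`E(yᵀAy/σ̂²) = n { tr(AV)/(n-p-2) - 2 tr(AVPV)/((n-p)(n-p-2))
  + βᵀXᵀAXβ/(σ²(n-p-2)) }`. -/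
theorem stmt_7 (n p : ℕ) (hnp : p + 2 < n) (X : Matrix (Fin n) (Fin p) ℝ)
    (hX : X.rank = p) (β : Fin p → ℝ) (V : Matrix (Fin n) (Fin n) ℝ)
    (hV : V.PosDef) (W : Matrix (Fin p) (Fin p) ℝ) (hW : W.PosDef)
    (σ2 : ℝ) (hσ : 0 < σ2)
    (P A : Matrix (Fin n) (Fin n) ℝ)
    (hP : P = V⁻¹ - V⁻¹ * X * (Xᵀ * V⁻¹ * X)⁻¹ * Xᵀ * V⁻¹)
    (hA : A = V⁻¹ - V⁻¹ * X * (Xᵀ * V⁻¹ * X + W⁻¹)⁻¹ * Xᵀ * V⁻¹) :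
    (∫ y : Fin n → ℝ,
        ((y ⬝ᵥ A.mulVec y) / (y ⬝ᵥ P.mulVec y / n)) * gaussPdf (X.mulVec β) (σ2 • V) y)
      = n * ((A * V).trace / ((n : ℝ) - p - 2)
          - 2 * (A * V * P * V).trace / (((n : ℝ) - p) * ((n : ℝ) - p - 2))
          + X.mulVec β ⬝ᵥ A.mulVec (X.mulVec β) / (σ2 * ((n : ℝ) - p - 2))) := by
  obtain ⟨hPt, hPX, hPVP, htr⟩ := residual_matrix_properties hX hV hP
  obtain ⟨L, d, hLV, hLP, hd⟩ := exists_factor_diagonal hV hPt hPVP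
  set μ := X *ᵥ β with hμ
  set m : ℝ := (n : ℝ) - p with hmdef
  have h2 : 2 < m := by
    have : (p : ℝ) + 2 < n := by exact_mod_cast hnp
    linarith
  obtain ⟨s, hs, rfl⟩ : ∃ s : ℝ, 0 < s ∧ s ^ 2 = σ2 :=
    ⟨√σ2, Real.sqrt_pos.mpr hσ, Real.sq_sqrt hσ.le⟩
  have hm : ∑ j, d j = m := by
    rw [← trace_diagonal, ← hLP, trace_mul_comm, ← Matrix.mul_assoc, hLV, trace_mul_comm, htr]
  have hdetL : L.det ≠ 0 := fun h => by
    have := hV.det_pos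
    rw [← hLV, det_mul, h, zero_mul] at this
    exact this.false
  have hT : (s • L).det ≠ 0 := by
    rw [det_smul]
    positivity
  have hPμ : P *ᵥ μ = 0 := by rw [hμ, mulVec_mulVec, hPX, zero_mulVec]
  have hconj : ∀ (B : Matrix (Fin n) (Fin n) ℝ) (z : Fin n → ℝ),
      (L *ᵥ z) ⬝ᵥ B *ᵥ (L *ᵥ z) = z ⬝ᵥ (Lᵀ * B * L) *ᵥ z := fun B z => by
    rw [mulVec_mulVec, ← vecMul_transpose L z, ← dotProduct_mulVec, mulVec_mulVec,
      Matrix.mul_assoc]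
  have hden : ∀ z : Fin n → ℝ,
      (μ + (s • L) *ᵥ z) ⬝ᵥ P *ᵥ (μ + (s • L) *ᵥ z) = s ^ 2 * ∑ j, d j * z j ^ 2 := fun z => by
    have hμP : ∀ w, μ ⬝ᵥ P *ᵥ w = 0 := fun w => by
      rw [dotProduct_mulVec, ← hPt, vecMul_transpose, hPμ, zero_dotProduct]
    rw [mulVec_add, hPμ, zero_add, add_dotProduct, hμP, zero_add, smul_mulVec, mulVec_smul,
      smul_dotProduct, dotProduct_smul, hconj, hLP, smul_eq_mul, smul_eq_mul, ← mul_assoc, ← sq]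
    congr 1
    simp only [dotProduct, mulVec_diagonal]
    exact Finset.sum_congr rfl fun j _ => by ring
  let l : Fin n → ℝ := s • (Lᵀ *ᵥ (A *ᵥ μ) + Lᵀ *ᵥ (Aᵀ *ᵥ μ))
  let C : Matrix (Fin n) (Fin n) ℝ := Lᵀ * A * L
  have hnum : ∀ z : Fin n → ℝ, (μ + (s • L) *ᵥ z) ⬝ᵥ A *ᵥ (μ + (s • L) *ᵥ z)
      = μ ⬝ᵥ A *ᵥ μ + l ⬝ᵥ z + z ⬝ᵥ (s ^ 2 • C) *ᵥ z := fun z => by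
    have h1 : (L *ᵥ z) ⬝ᵥ A *ᵥ μ = (Lᵀ *ᵥ (A *ᵥ μ)) ⬝ᵥ z := by
      rw [dotProduct_comm, dotProduct_mulVec, ← mulVec_transpose]
    have h3 : μ ⬝ᵥ A *ᵥ (L *ᵥ z) = (Lᵀ *ᵥ (Aᵀ *ᵥ μ)) ⬝ᵥ z := by
      rw [dotProduct_mulVec, dotProduct_mulVec, ← mulVec_transpose, ← mulVec_transpose]
    simp only [mulVec_add, add_dotProduct, dotProduct_add, smul_mulVec, mulVec_smul,
      smul_dotProduct, dotProduct_smul, smul_eq_mul, hconj, h1, h3, l, C]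
    ring
  have hint : ∀ z : Fin n → ℝ, |(s • L).det| *
      (((μ + (s • L) *ᵥ z) ⬝ᵥ A *ᵥ (μ + (s • L) *ᵥ z)) /
        ((μ + (s • L) *ᵥ z) ⬝ᵥ P *ᵥ (μ + (s • L) *ᵥ z) / n) *
        gaussPdf μ (s ^ 2 • V) (μ + (s • L) *ᵥ z))
      = (n / s ^ 2 * (√(2 * π) ^ n)⁻¹) *
        ((μ ⬝ᵥ A *ᵥ μ + l ⬝ᵥ z + z ⬝ᵥ (s ^ 2 • C) *ᵥ z) / (∑ j, d j * z j ^ 2)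
          * stdGaussKernel z) := fun z => by
    rw [mul_left_comm, abs_det_mul_gaussPdf μ hV hLV hs, hnum, hden]
    simp only [div_eq_mul_inv, mul_inv, inv_inv]
    ring
  rw [integral_comp_affine μ hT, ← integral_const_mul]
  simp_rw [hint]
  rw [integral_const_mul, integral_quadratic_div_sum_sq d hd hm h2, Fintype.card_fin]
  have hinv : ∀ i, (m - 2 + 2 * d i)⁻¹ = (m - 2)⁻¹ - 2 * d i / (m * (m - 2)) := fun i => by
    have h3 : m - 2 ≠ 0 := by linarith
    have h4 : m ≠ 0 := by linarith
    rcases hd i with h | h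
    · simp [h]
    · rw [h, mul_one, sub_add_cancel]
      field_simp
  have htr1 : ∑ i, C i i = (A * V).trace := by
    change C.trace = _
    rw [trace_mul_comm, ← Matrix.mul_assoc, hLV, trace_mul_comm]
  have htr2 : ∑ i, C i i * d i = (A * V * P * V).trace := by
    have h5 : ∑ i, C i i * d i = (C * diagonal d).trace := by
      simp [trace, mul_diagonal]
    have h6 : C * diagonal d = Lᵀ * (A * L * Lᵀ * P * L) := by
      rw [← hLP]
      simp only [C, Matrix.mul_assoc]
    rw [h5, h6, trace_mul_comm, ← hLV]
    simp only [Matrix.mul_assoc]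
  have hsum : ∑ i, (s ^ 2 • C) i i * (m - 2 + 2 * d i)⁻¹
      = s ^ 2 * ((A * V).trace * (m - 2)⁻¹ - 2 * (A * V * P * V).trace / (m * (m - 2))) := by
    rw [← htr1, ← htr2, Finset.sum_mul, Finset.mul_sum, Finset.sum_div,
      ← Finset.sum_sub_distrib, Finset.mul_sum]
    refine Finset.sum_congr rfl fun i _ => ?_
    rw [hinv, Matrix.smul_apply, smul_eq_mul]
    ring
  rw [hsum]
  have hπ : √(2 * π) ^ n ≠ 0 := by positivity
  have h3 : m - 2 ≠ 0 := by linarith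
  have h4 : m ≠ 0 := by linarith
  field_simp
  ring
end

section
/- (Proposition 1) In the normal linear regression model y = Xβ + ε with ε ~ N_n(0, σ²V) and normal prior β ~ N_p(0, σ²W), let f_π(y|σ²) denote the marginal density of y, σ̂² = y^t P y / n with P = V^{−1} − V^{−1} X (X^t V^{−1} X)^{−1} X^t V^{−1}, and let ỹ be an independent copy of y. Define the information I_{π,1}(ω) = E[ −2 log f_π(ỹ|σ̂²) ] and the criterion IC_{π,1} = −2 log f_π(y|σ̂²) + 2n/(n − p − 2). Then IC_{π,1} is an unbiased estimator of I_{π,1}(ω): E(IC_{π,1}) = I_{π,1}(ω). Equivalently, E[ ỹ^t A ỹ / σ̂² ] − E[ y^t A y / σ̂² ] = 2n/(n − p − 2), where A = V^{−1} − V^{−1} X (X^t V^{−1} X + W^{−1})^{−1} X^t V^{−1}. -/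
open MeasureTheory Matrix Real Filter

/-- `-2 log f_π(y | s2)`, minus twice the log of the Bayesian marginal likelihood
of the normal linear regression model with normal prior, evaluated at the
variance value `s2`:
`n log(2π s2) + log|V| + log|W Xᵀ V⁻¹ X + I_p| + yᵀ A y / s2`. -/
noncomputable def neg2logMarg (n p : ℕ) (X : Matrix (Fin n) (Fin p) ℝ)
    (V : Matrix (Fin n) (Fin n) ℝ) (W : Matrix (Fin p) (Fin p) ℝ)
    (A : Matrix (Fin n) (Fin n) ℝ) (s2 : ℝ) (y : Fin n → ℝ) : ℝ :=
  n * Real.log (2 * π * s2) + Real.log V.det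
    + Real.log (W * Xᵀ * V⁻¹ * X + 1).det + (y ⬝ᵥ A.mulVec y) / s2

open ProbabilityTheory in
theorem pi_gaussianReal_eq_withDensity (ι : Type*) [Fintype ι] :
    Measure.pi (fun _ : ι => gaussianReal 0 1) =
      (volume : Measure (ι → ℝ)).withDensity
        (fun w => ENNReal.ofReal (∏ i, gaussianPDFReal 0 1 (w i))) := by
  refine Measure.pi_eq fun s hs => ?_
  rw [withDensity_apply _ (MeasurableSet.univ_pi hs), volume_pi, Measure.restrict_pi_pi,
    ← ofReal_integral_eq_lintegral_ofReal
      (Integrable.fintype_prod fun i => (integrable_gaussianPDFReal 0 1).restrict)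
      (ae_of_all _ fun w => Finset.prod_nonneg fun i _ => gaussianPDFReal_nonneg 0 1 _),
    integral_fintype_prod_eq_prod (fun _ => gaussianPDFReal 0 1),
    ENNReal.ofReal_prod_of_nonneg
      fun i _ => integral_nonneg fun x => gaussianPDFReal_nonneg 0 1 x]
  simp_rw [gaussianReal_apply_eq_integral 0 one_ne_zero]

open ProbabilityTheory in
theorem integral_pi_gaussianReal {ι : Type*} [Fintype ι] (f : (ι → ℝ) → ℝ) :
    ∫ w, f w ∂Measure.pi (fun _ : ι => gaussianReal 0 1) =
      ∫ w, f w * ∏ i, gaussianPDFReal 0 1 (w i) := by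
  have h : ∀ w : ι → ℝ, 0 ≤ ∏ i, gaussianPDFReal 0 1 (w i) :=
    fun w => Finset.prod_nonneg fun i _ => gaussianPDFReal_nonneg 0 1 _
  rw [pi_gaussianReal_eq_withDensity, integral_withDensity_eq_integral_toReal_smul
    (by fun_prop) (ae_of_all _ fun _ => ENNReal.ofReal_lt_top)]
  simp_rw [ENNReal.toReal_ofReal (h _), smul_eq_mul, mul_comm]

theorem prod_gaussianPDFReal {ι : Type*} [Fintype ι] (w : ι → ℝ) :
    ∏ i, ProbabilityTheory.gaussianPDFReal 0 1 (w i) =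
      (√(2 * π) ^ Fintype.card ι)⁻¹ * rexp (-(w ⬝ᵥ w) / 2) := by
  simp only [ProbabilityTheory.gaussianPDFReal, Finset.prod_mul_distrib, ← Real.exp_sum,
    dotProduct, ← Finset.sum_neg_distrib, Finset.sum_div]
  simp [pow_two, mul_pow, mul_comm]

theorem integral_comp_mulVec {n : ℕ} (M : Matrix (Fin n) (Fin n) ℝ) (hM : M.det ≠ 0)
    (f : (Fin n → ℝ) → ℝ) :
    ∫ w, f (M.mulVec w) = |M.det|⁻¹ * ∫ y, f y := by
  have hemb : MeasurableEmbedding (toLin' M) := by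
    have := (LinearEquiv.ofIsUnitDet (f := toLin' M) (v := Pi.basisFun ℝ (Fin n))
      (v' := Pi.basisFun ℝ (Fin n)) (by simpa using hM)).toContinuousLinearEquiv.toHomeomorph.measurableEmbedding
    exact this
  have h := hemb.integral_map (μ := volume) f
  rw [Real.map_matrix_volume_pi_eq_smul_volume_pi hM, integral_smul_measure] at h
  simp only [toLin'_apply] at h
  rw [← h, ENNReal.toReal_ofReal (abs_nonneg _), abs_inv, smul_eq_mul]

theorem gaussPdf_add_mulVec {n : ℕ} (b : Fin n → ℝ) {M S : Matrix (Fin n) (Fin n) ℝ}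
    (hM : M.det ≠ 0) (hS : M * Mᵀ = S) (w : Fin n → ℝ) :
    gaussPdf b S (b + M.mulVec w) =
      |M.det|⁻¹ * ∏ i, ProbabilityTheory.gaussianPDFReal 0 1 (w i) := by
  have hu : IsUnit M.det := hM.isUnit
  have hq : (M.mulVec w) ⬝ᵥ S⁻¹.mulVec (M.mulVec w) = w ⬝ᵥ w := by
    rw [mulVec_mulVec, dotProduct_comm, dotProduct_mulVec, ← mulVec_transpose, mulVec_mulVec,
      ← hS, Matrix.mul_inv_rev, Matrix.mul_assoc, Matrix.nonsing_inv_mul _ hu, Matrix.mul_one,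
      ← transpose_nonsing_inv, ← transpose_mul, Matrix.nonsing_inv_mul _ hu]
    simp
  have hd : (2 * π) ^ n * S.det = (√(2 * π) ^ n * |M.det|) ^ 2 := by
    rw [← hS, det_mul, det_transpose, mul_pow (√(2 * π) ^ n), sq_abs, ← pow_mul, mul_comm n 2, pow_mul,
      Real.sq_sqrt (by positivity), sq]
  have hpos : 0 ≤ √(2 * π) ^ n * |M.det| := by positivity
  have hc : ((2 * π) ^ n * S.det) ^ (-(1 : ℝ) / 2) = (√(2 * π) ^ n * |M.det|)⁻¹ := by
    rw [hd, neg_div, Real.rpow_neg (sq_nonneg _), ← Real.sqrt_eq_rpow, Real.sqrt_sq hpos]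
  rw [gaussPdf, hc, add_sub_cancel_left, hq, prod_gaussianPDFReal, Fintype.card_fin, mul_inv]
  ring

theorem integral_mul_gaussPdf {n : ℕ} (b : Fin n → ℝ) {M S : Matrix (Fin n) (Fin n) ℝ}
    (hM : M.det ≠ 0) (hS : M * Mᵀ = S) (f : (Fin n → ℝ) → ℝ) :
    ∫ y, f y * gaussPdf b S y =
      ∫ w, f (b + M.mulVec w)
        ∂Measure.pi (fun _ : Fin n => ProbabilityTheory.gaussianReal 0 1) := by
  have hM' : |M.det| ≠ 0 := abs_ne_zero.2 hM
  rw [integral_pi_gaussianReal, ← integral_add_left_eq_self _ b]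
  have h := integral_comp_mulVec M hM (fun y => f (b + y) * gaussPdf b S (b + y))
  simp_rw [gaussPdf_add_mulVec b hM hS, mul_left_comm _ |M.det|⁻¹, integral_const_mul] at h
  exact (mul_left_cancel₀ (inv_ne_zero hM') h).symm

open ProbabilityTheory in
theorem integral_exp_neg_mul_sq_gaussianReal {t : ℝ} (ht : 0 ≤ t) :
    ∫ x, rexp (-t * x ^ 2) ∂gaussianReal 0 1 = (1 + 2 * t) ^ (-(1 : ℝ) / 2) := by
  rw [integral_gaussianReal_eq_integral_smul one_ne_zero]
  have h : ∀ x : ℝ, gaussianPDFReal 0 1 x • rexp (-t * x ^ 2) =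
      (√(2 * π))⁻¹ * rexp (-(t + 1 / 2) * x ^ 2) := by
    intro x
    simp only [gaussianPDFReal, smul_eq_mul, mul_assoc, ← Real.exp_add, NNReal.coe_one, mul_one,
      sub_zero]
    ring_nf
  simp_rw [h, integral_const_mul, integral_gaussian]
  rw [neg_div, Real.rpow_neg (by positivity), ← Real.sqrt_eq_rpow, ← Real.sqrt_inv,
    ← Real.sqrt_inv, ← Real.sqrt_mul (by positivity)]
  congr 1
  field_simp
  ring

open ProbabilityTheory in
theorem integral_exp_neg_mul_sum_sq {ι : Type*} [Fintype ι] (s : Finset ι) {t : ℝ}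
    (ht : 0 ≤ t) :
    ∫ w, rexp (-t * ∑ i ∈ s, w i ^ 2) ∂Measure.pi (fun _ : ι => gaussianReal 0 1) =
      (1 + 2 * t) ^ (-(s.card : ℝ) / 2) := by
  classical
  have h : ∀ w : ι → ℝ, rexp (-t * ∑ i ∈ s, w i ^ 2) =
      ∏ i, if i ∈ s then rexp (-t * w i ^ 2) else 1 := by
    intro w
    rw [Finset.mul_sum, Real.exp_sum, Finset.prod_ite_mem, Finset.univ_inter]
  simp_rw [h]
  rw [integral_fintype_prod_eq_prod
    (fun i (x : ℝ) => if i ∈ s then rexp (-t * x ^ 2) else 1)]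
  have h' : ∀ i, ∫ x, (if i ∈ s then rexp (-t * x ^ 2) else 1) ∂gaussianReal 0 1 =
      if i ∈ s then (1 + 2 * t) ^ (-(1 : ℝ) / 2) else 1 := by
    intro i
    split_ifs
    · exact integral_exp_neg_mul_sq_gaussianReal ht
    · simp
  simp_rw [h']
  rw [Finset.prod_ite_mem, Finset.univ_inter, Finset.prod_const, ← Real.rpow_natCast,
    ← Real.rpow_mul (by positivity)]
  congr 1
  ring

theorem lintegral_Ioi_one_add_two_mul_rpow {k : ℝ} (hk : 2 < k) :
    ∫⁻ t in Set.Ioi (0 : ℝ), ENNReal.ofReal ((1 + 2 * t) ^ (-k / 2)) =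
      ENNReal.ofReal (k - 2)⁻¹ := by
  have hk' : k - 2 ≠ 0 := by linarith
  have hderiv : ∀ t ∈ Set.Ici (0 : ℝ),
      HasDerivAt (fun t : ℝ => -(k - 2)⁻¹ * (1 + 2 * t) ^ (-((k - 2) / 2)))
        ((1 + 2 * t) ^ (-k / 2)) t := by
    intro t ht
    have ht' : 0 < 1 + 2 * t := by linarith [Set.mem_Ici.1 ht]
    have h1 : HasDerivAt (fun t : ℝ => 1 + 2 * t) 2 t := by
      simpa using ((hasDerivAt_id t).const_mul 2).const_add 1
    convert! (h1.rpow_const (p := -((k - 2) / 2)) (Or.inl ht'.ne')).const_mul (-(k - 2)⁻¹) using 1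
    rw [show -((k - 2) / 2) - 1 = -k / 2 by ring]
    field_simp
  have hnonneg : ∀ t ∈ Set.Ioi (0 : ℝ), 0 ≤ (1 + 2 * t) ^ (-k / 2) := fun t ht =>
    Real.rpow_nonneg (by linarith [Set.mem_Ioi.1 ht]) _
  have hlim : Tendsto (fun t : ℝ => -(k - 2)⁻¹ * (1 + 2 * t) ^ (-((k - 2) / 2))) atTop
      (nhds 0) := by
    have h1 : Tendsto (fun t : ℝ => 1 + 2 * t) atTop atTop :=
      tendsto_atTop_add_const_left _ _ (tendsto_id.const_mul_atTop two_pos)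
    simpa using ((tendsto_rpow_neg_atTop (y := (k - 2) / 2) (by linarith)).comp h1).const_mul
      (-(k - 2)⁻¹)
  rw [← ofReal_integral_eq_lintegral_ofReal
    (integrableOn_Ioi_deriv_of_nonneg' hderiv hnonneg hlim)
    ((ae_restrict_iff' measurableSet_Ioi).2 (ae_of_all _ hnonneg)),
    integral_Ioi_of_hasDerivAt_of_nonneg' hderiv hnonneg hlim]
  simp

theorem lintegral_Ioi_exp_neg_mul {q : ℝ} (hq : 0 < q) :
    ∫⁻ t in Set.Ioi (0 : ℝ), ENNReal.ofReal (rexp (-t * q)) = ENNReal.ofReal q⁻¹ := by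
  have h := integrableOn_exp_mul_Ioi (a := -q) (by linarith) 0
  have h' := integral_exp_mul_Ioi (a := -q) (by linarith) 0
  simp_rw [show ∀ t : ℝ, -t * q = -q * t by intro t; ring]
  rw [← ofReal_integral_eq_lintegral_ofReal h (ae_of_all _ fun t => (Real.exp_pos _).le), h']
  simp

open ProbabilityTheory in
theorem ae_sum_sq_pos {ι : Type*} [Fintype ι] {s : Finset ι} (hs : s.Nonempty) :
    ∀ᵐ w ∂Measure.pi (fun _ : ι => gaussianReal 0 1), 0 < ∑ i ∈ s, w i ^ 2 := by
  obtain ⟨j, hj⟩ := hs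
  have := nullSingletonClass_gaussianReal (μ := 0) (v := 1) one_ne_zero
  have h : ∀ᵐ x ∂gaussianReal 0 1, x ≠ 0 := by
    simp [ae_iff]
  filter_upwards [(measurePreserving_eval (fun _ : ι => gaussianReal 0 1)
    j).quasiMeasurePreserving.ae h] with w hw
  exact Finset.sum_pos' (fun i _ => sq_nonneg _) ⟨j, hj, sq_pos_of_ne_zero hw⟩

open ProbabilityTheory in
theorem lintegral_inv_sum_sq {ι : Type*} [Fintype ι] {s : Finset ι} (hs : 2 < s.card) :
    ∫⁻ w, ENNReal.ofReal (∑ i ∈ s, w i ^ 2)⁻¹ ∂Measure.pi (fun _ : ι => gaussianReal 0 1) =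
      ENNReal.ofReal ((s.card : ℝ) - 2)⁻¹ := by
  have hk : (2 : ℝ) < s.card := by exact_mod_cast hs
  calc ∫⁻ w, ENNReal.ofReal (∑ i ∈ s, w i ^ 2)⁻¹ ∂Measure.pi (fun _ : ι => gaussianReal 0 1)
      = ∫⁻ w, (∫⁻ t in Set.Ioi (0 : ℝ), ENNReal.ofReal (rexp (-t * ∑ i ∈ s, w i ^ 2)))
          ∂Measure.pi (fun _ : ι => gaussianReal 0 1) := by
        refine lintegral_congr_ae ?_
        filter_upwards [ae_sum_sq_pos (Finset.card_pos.1 (by omega : 0 < s.card))] with w hw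
        exact (lintegral_Ioi_exp_neg_mul hw).symm
    _ = ∫⁻ t in Set.Ioi (0 : ℝ), (∫⁻ w, ENNReal.ofReal (rexp (-t * ∑ i ∈ s, w i ^ 2))
          ∂Measure.pi (fun _ : ι => gaussianReal 0 1)) := by
        refine lintegral_lintegral_swap (Measurable.aemeasurable ?_)
        unfold Function.uncurry
        fun_prop
    _ = ∫⁻ t in Set.Ioi (0 : ℝ), ENNReal.ofReal ((1 + 2 * t) ^ (-(s.card : ℝ) / 2)) := by
        refine setLIntegral_congr_fun measurableSet_Ioi fun t ht => ?_
        have ht' : 0 ≤ t := (Set.mem_Ioi.1 ht).le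
        have hint : Integrable (fun w : ι → ℝ => rexp (-t * ∑ i ∈ s, w i ^ 2))
            (Measure.pi fun _ => gaussianReal 0 1) := by
          refine Integrable.of_bound (Measurable.aestronglyMeasurable (by fun_prop)) 1 (ae_of_all _ fun w => ?_)
          rw [Real.norm_eq_abs, Real.abs_exp, Real.exp_le_one_iff, neg_mul, neg_nonpos]
          exact mul_nonneg ht' (Finset.sum_nonneg fun i _ => sq_nonneg _)
        rw [← ofReal_integral_eq_lintegral_ofReal hint
          (ae_of_all _ fun w => (Real.exp_pos _).le), integral_exp_neg_mul_sum_sq s ht']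
    _ = _ := lintegral_Ioi_one_add_two_mul_rpow hk

open ProbabilityTheory in
theorem integrable_inv_sum_sq {ι : Type*} [Fintype ι] {s : Finset ι} (hs : 2 < s.card) :
    Integrable (fun w : ι → ℝ => (∑ i ∈ s, w i ^ 2)⁻¹)
      (Measure.pi fun _ => gaussianReal 0 1) := by
  refine (lintegral_ofReal_ne_top_iff_integrable (Measurable.aestronglyMeasurable (by fun_prop))
    (ae_of_all _ fun w => inv_nonneg.2 (Finset.sum_nonneg fun i _ => sq_nonneg _))).1 ?_
  rw [lintegral_inv_sum_sq hs]
  exact ENNReal.ofReal_ne_top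

open ProbabilityTheory in
theorem integral_inv_sum_sq {ι : Type*} [Fintype ι] {s : Finset ι} (hs : 2 < s.card) :
    ∫ w, (∑ i ∈ s, w i ^ 2)⁻¹ ∂Measure.pi (fun _ : ι => gaussianReal 0 1) =
      ((s.card : ℝ) - 2)⁻¹ := by
  have hk : (2 : ℝ) < s.card := by exact_mod_cast hs
  rw [integral_eq_lintegral_of_nonneg_ae
    (ae_of_all _ fun w => inv_nonneg.2 (Finset.sum_nonneg fun i _ => sq_nonneg _))
    (integrable_inv_sum_sq hs).aestronglyMeasurable, lintegral_inv_sum_sq hs,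
    ENNReal.toReal_ofReal (inv_nonneg.2 (by linarith))]

open ProbabilityTheory in
theorem memLp_two_eval_pi_gaussianReal {ι : Type*} [Fintype ι] (i : ι) :
    MemLp (fun w : ι → ℝ => w i) 2 (Measure.pi fun _ => gaussianReal 0 1) :=
  (memLp_id_gaussianReal (μ := 0) (v := 1) 2).comp_measurePreserving
    (measurePreserving_eval (fun _ : ι => gaussianReal 0 1) i)

open ProbabilityTheory in
theorem memLp_two_affine_pi_gaussianReal {ι : Type*} [Fintype ι] (c : ℝ) (a : ι → ℝ) :
    MemLp (fun w : ι → ℝ => c + ∑ i, a i * w i) 2 (Measure.pi fun _ => gaussianReal 0 1) :=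
  MemLp.add (f := fun _ => c) (memLp_const c) (memLp_finsetSum Finset.univ fun i _ =>
    (memLp_two_eval_pi_gaussianReal i).const_mul (a i))

open ProbabilityTheory in
theorem integrable_sum_sq {ι : Type*} [Fintype ι] (s : Finset ι) :
    Integrable (fun w : ι → ℝ => ∑ i ∈ s, w i ^ 2) (Measure.pi fun _ => gaussianReal 0 1) :=
  integrable_finsetSum _ fun i _ => (memLp_two_eval_pi_gaussianReal i).integrable_sq

open ProbabilityTheory in
theorem integral_sum_sq {ι : Type*} [Fintype ι] (s : Finset ι) :
    ∫ w, ∑ i ∈ s, w i ^ 2 ∂Measure.pi (fun _ : ι => gaussianReal 0 1) = s.card := by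
  have h : ∫ x, x ^ 2 ∂gaussianReal 0 1 = 1 := by
    have h1 := variance_of_integral_eq_zero (X := fun x : ℝ => x) (μ := gaussianReal 0 1)
      (by fun_prop) integral_id_gaussianReal
    rw [variance_fun_id_gaussianReal] at h1
    exact_mod_cast h1.symm
  rw [integral_finsetSum _ fun i _ => (memLp_two_eval_pi_gaussianReal i).integrable_sq]
  have h' : ∀ i : ι, ∫ w, w i ^ 2 ∂Measure.pi (fun _ : ι => gaussianReal 0 1) = 1 := fun i =>
    (integral_comp_eval (μ := fun _ : ι => gaussianReal 0 1) (f := fun x : ℝ => x ^ 2)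
      (by fun_prop)).trans h
  simp [h']

theorem integrable_dotProduct_mulVec_self {Ω : Type*} [MeasurableSpace Ω] {μ : Measure Ω}
    {m : Type*} [Fintype m] (K : Matrix m m ℝ) {u : Ω → m → ℝ}
    (hu : ∀ j, MemLp (fun ω => u ω j) 2 μ) :
    Integrable (fun ω => u ω ⬝ᵥ K.mulVec (u ω)) μ := by
  simp only [dotProduct, mulVec, Finset.mul_sum]
  refine integrable_finsetSum _ fun i _ => integrable_finsetSum _ fun j _ => ?_
  simp_rw [mul_left_comm _ (K i j)]
  exact ((hu i).integrable_mul (hu j)).const_mul _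

open ProbabilityTheory in
theorem indepFun_of_dependsOn {ι : Type*} [Fintype ι] [DecidableEq ι] (s : Finset ι)
    {f g : (ι → ℝ) → ℝ} (hf : Measurable f) (hg : Measurable g)
    (hfs : ∀ w, f w = f (fun i => if i ∈ s then w i else 0))
    (hgs : ∀ w, g w = g (fun i => if i ∈ s then 0 else w i)) :
    IndepFun f g (Measure.pi fun _ : ι => gaussianReal 0 1) := by
  have hind : iIndepFun (fun i (w : ι → ℝ) => w i) (Measure.pi fun _ : ι => gaussianReal 0 1) :=
    iIndepFun_pi (X := fun (_ : ι) (x : ℝ) => x) fun i => aemeasurable_id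
  have h := (hind.indepFun_finset s sᶜ disjoint_compl_right fun i => measurable_pi_apply i).comp
    (φ := fun v => f (fun i => if hi : i ∈ s then v ⟨i, hi⟩ else 0))
    (ψ := fun v => g (fun i => if hi : i ∈ s then 0 else v ⟨i, Finset.mem_compl.2 hi⟩))
    (hf.comp (measurable_pi_iff.2 fun i => by split_ifs <;> fun_prop))
    (hg.comp (measurable_pi_iff.2 fun i => by split_ifs <;> fun_prop))
  convert h using 1
  · funext w; rw [hfs w]; simp
  · funext w; rw [hgs w]; simp

theorem abs_log_le_add_inv {x : ℝ} (hx : 0 < x) : |Real.log x| ≤ x + x⁻¹ := by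
  have h1 := Real.log_le_self hx.le
  have h2 := Real.log_le_self (inv_pos.2 hx).le
  rw [Real.log_inv] at h2
  have := inv_pos.2 hx
  exact abs_le.2 ⟨by linarith, by linarith⟩

theorem integrable_log_of_integrable_inv {Ω : Type*} [MeasurableSpace Ω] {μ : Measure Ω}
    {q : Ω → ℝ} (hpos : ∀ᵐ ω ∂μ, 0 < q ω) (hq : Integrable q μ)
    (hinv : Integrable (fun ω => (q ω)⁻¹) μ) : Integrable (fun ω => Real.log (q ω)) μ := by
  refine (hq.add hinv).mono' (Real.measurable_log.comp_aemeasurable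
    hq.aemeasurable).aestronglyMeasurable ?_
  filter_upwards [hpos] with ω hω using abs_log_le_add_inv hω

open ProbabilityTheory in
theorem integral_add_div_of_indepFun {Ω : Type*} [MeasurableSpace Ω] {μ : Measure Ω}
    [IsProbabilityMeasure μ] {q r : Ω → ℝ} (c : ℝ) (hpos : ∀ᵐ ω ∂μ, 0 < q ω)
    (hinv : Integrable (fun ω => (q ω)⁻¹) μ) (hr : Integrable r μ) (hind : IndepFun q r μ) :
    Integrable (fun ω => (q ω + r ω) / (q ω / c)) μ ∧
      ∫ ω, (q ω + r ω) / (q ω / c) ∂μ = c * (1 + (∫ ω, r ω ∂μ) * ∫ ω, (q ω)⁻¹ ∂μ) := by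
  have hind' : IndepFun r (fun ω => (q ω)⁻¹) μ :=
    hind.symm.comp measurable_id measurable_inv
  have hprod : Integrable (fun ω => r ω * (q ω)⁻¹) μ := hind'.integrable_mul hr hinv
  have hae : (fun ω => (q ω + r ω) / (q ω / c)) =ᵐ[μ] fun ω => c * (1 + r ω * (q ω)⁻¹) := by
    filter_upwards [hpos] with ω hω
    rw [div_div_eq_mul_div]
    field_simp
  refine ⟨(((integrable_const 1).add hprod).const_mul c).congr hae.symm, ?_⟩
  rw [integral_congr_ae hae, integral_const_mul, integral_add (integrable_const 1) hprod,
    hind'.integral_fun_mul_eq_mul_integral hr.aestronglyMeasurable hinv.aestronglyMeasurable]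
  simp

open scoped MatrixOrder in
theorem Matrix.PosSemidef.exists_eq_transpose_mul_self {n : Type*} [Fintype n]
    [DecidableEq n] {V : Matrix n n ℝ} (hV : V.PosSemidef) : ∃ B : Matrix n n ℝ, V = Bᵀ * B := by
  refine ⟨CFC.sqrt V, ?_⟩
  have h := (CFC.sqrt_nonneg V).posSemidef.isHermitian.eq
  rw [conjTranspose_eq_transpose_of_trivial] at h
  rw [h, CFC.sqrt_mul_sqrt_self V hV.nonneg]

theorem Matrix.IsHermitian.exists_orthogonal_diagonalization {n : Type*} [Fintype n]
    [DecidableEq n] {A : Matrix n n ℝ} (hA : A.IsHermitian) :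
    ∃ U : Matrix n n ℝ, U * Uᵀ = 1 ∧ Uᵀ * A * U = diagonal hA.eigenvalues := by
  have hU : star (hA.eigenvectorUnitary : Matrix n n ℝ) =
      (hA.eigenvectorUnitary : Matrix n n ℝ)ᵀ := by
    rw [star_eq_conjTranspose, conjTranspose_eq_transpose_of_trivial]
  refine ⟨hA.eigenvectorUnitary, ?_, ?_⟩ <;> rw [← hU]
  · exact (Unitary.mem_iff.1 hA.eigenvectorUnitary.2).2
  · exact (Unitary.conjStarAlgAut_star_apply _ _).symm.trans
      hA.conjStarAlgAut_star_eigenvectorUnitary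

theorem exists_mul_transpose_eq_and_diagonal {n : Type*} [Fintype n] [DecidableEq n]
    {V P : Matrix n n ℝ} (hV : V.PosDef) (hP : Pᵀ = P) (hPV : P * V * P = P) :
    ∃ (T : Matrix n n ℝ) (s : Finset n), T * Tᵀ = V ∧
      Tᵀ * P * T = diagonal (fun i => if i ∈ s then 1 else 0) ∧
      (s.card : ℝ) = (P * V).trace := by
  obtain ⟨B, hB⟩ := hV.posSemidef.exists_eq_transpose_mul_self
  have hQ : (B * P * Bᵀ).IsHermitian := by
    rw [IsHermitian, conjTranspose_eq_transpose_of_trivial]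
    simp [transpose_mul, hP, Matrix.mul_assoc]
  obtain ⟨U, hUU, hUd⟩ := hQ.exists_orthogonal_diagonalization
  have hT : (Bᵀ * U) * (Bᵀ * U)ᵀ = V := by
    rw [transpose_mul, transpose_transpose, Matrix.mul_assoc, ← Matrix.mul_assoc U, hUU,
      Matrix.one_mul, ← hB]
  have hdiag : (Bᵀ * U)ᵀ * P * (Bᵀ * U) = diagonal hQ.eigenvalues := by
    rw [← hUd, transpose_mul, transpose_transpose]
    simp only [Matrix.mul_assoc]
  have hidem : diagonal hQ.eigenvalues * diagonal hQ.eigenvalues = diagonal hQ.eigenvalues := by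
    rw [← hdiag]
    calc (Bᵀ * U)ᵀ * P * (Bᵀ * U) * ((Bᵀ * U)ᵀ * P * (Bᵀ * U))
        = (Bᵀ * U)ᵀ * (P * ((Bᵀ * U) * (Bᵀ * U)ᵀ) * P) * (Bᵀ * U) := by
          simp only [Matrix.mul_assoc]
      _ = _ := by rw [hT, hPV, Matrix.mul_assoc]
  have h01 : ∀ i, hQ.eigenvalues i = if i ∈ Finset.univ.filter (hQ.eigenvalues · = 1)
      then 1 else 0 := by
    intro i
    have h := congrFun (congrFun hidem i) i
    rw [diagonal_mul_diagonal, diagonal_apply_eq, diagonal_apply_eq] at h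
    rcases IsIdempotentElem.iff_eq_zero_or_one.1 h with h | h <;> simp [h]
  have hdiag' : (Bᵀ * U)ᵀ * P * (Bᵀ * U) = diagonal (fun i =>
      if i ∈ Finset.univ.filter (hQ.eigenvalues · = 1) then 1 else 0) := by
    rw [hdiag]; exact congrArg diagonal (funext h01)
  refine ⟨Bᵀ * U, _, hT, hdiag', ?_⟩
  rw [← hT, ← Matrix.mul_assoc, trace_mul_comm, ← Matrix.mul_assoc, hdiag', trace_diagonal]
  simp

section Projection

variable {n p : ℕ} {X : Matrix (Fin n) (Fin p) ℝ} {V P : Matrix (Fin n) (Fin n) ℝ}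

theorem posDef_transpose_mul_inv_mul (hX : X.rank = p) (hV : V.PosDef) :
    (Xᵀ * V⁻¹ * X).PosDef := by
  have hinj : Function.Injective X.mulVec := by
    rw [mulVec_injective_iff]
    exact linearIndependent_iff_card_eq_finrank_span.2 (by
      rw [Fintype.card_fin, Set.finrank, ← rank_eq_finrank_span_cols, hX])
  simpa [conjTranspose_eq_transpose_of_trivial] using hV.inv.conjTranspose_mul_mul_same hinj

theorem residual_mul_design (hG : IsUnit (Xᵀ * V⁻¹ * X).det)
    (hP : P = V⁻¹ - V⁻¹ * X * (Xᵀ * V⁻¹ * X)⁻¹ * Xᵀ * V⁻¹) : P * X = 0 := by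
  have h : V⁻¹ * X * (Xᵀ * V⁻¹ * X)⁻¹ * Xᵀ * V⁻¹ * X =
      V⁻¹ * X * ((Xᵀ * V⁻¹ * X)⁻¹ * (Xᵀ * V⁻¹ * X)) := by simp only [Matrix.mul_assoc]
  rw [hP, Matrix.sub_mul, h, Matrix.nonsing_inv_mul _ hG, Matrix.mul_one, sub_self]

theorem residual_transpose (hV : Vᵀ = V)
    (hP : P = V⁻¹ - V⁻¹ * X * (Xᵀ * V⁻¹ * X)⁻¹ * Xᵀ * V⁻¹) : Pᵀ = P := by
  rw [hP]
  simp [transpose_mul, transpose_nonsing_inv, hV, Matrix.mul_assoc]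

theorem residual_mul_cov (hV : IsUnit V.det)
    (hP : P = V⁻¹ - V⁻¹ * X * (Xᵀ * V⁻¹ * X)⁻¹ * Xᵀ * V⁻¹) :
    P * V = 1 - V⁻¹ * X * (Xᵀ * V⁻¹ * X)⁻¹ * Xᵀ := by
  rw [hP, Matrix.sub_mul, Matrix.nonsing_inv_mul _ hV, Matrix.mul_assoc _ V⁻¹ V,
    Matrix.nonsing_inv_mul _ hV, Matrix.mul_one]

theorem trace_residual_mul_cov (hV : IsUnit V.det) (hG : IsUnit (Xᵀ * V⁻¹ * X).det)
    (hP : P = V⁻¹ - V⁻¹ * X * (Xᵀ * V⁻¹ * X)⁻¹ * Xᵀ * V⁻¹) : (P * V).trace = n - p := by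
  rw [residual_mul_cov hV hP, trace_sub, trace_mul_comm, ← Matrix.mul_assoc, ← Matrix.mul_assoc,
    Matrix.mul_nonsing_inv _ hG]
  simp

/-- Coordinates in which the noise is standard normal, the residual quadratic form is a partial
sum of squares, and the sufficient statistic `Xᵀ V⁻¹ y` involves only the other coordinates. -/
theorem exists_canonical_coordinates (hX : X.rank = p) (hV : V.PosDef) {σ2 : ℝ} (hσ : 0 < σ2)
    (hP : P = V⁻¹ - V⁻¹ * X * (Xᵀ * V⁻¹ * X)⁻¹ * Xᵀ * V⁻¹) :
    ∃ (M : Matrix (Fin n) (Fin n) ℝ) (s : Finset (Fin n)), M.det ≠ 0 ∧ M * Mᵀ = σ2 • V ∧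
      (s.card : ℝ) = n - p ∧
      (∀ β w, (X.mulVec β + M.mulVec w) ⬝ᵥ P.mulVec (X.mulVec β + M.mulVec w) =
        σ2 * ∑ i ∈ s, w i ^ 2) ∧
      ∀ i ∈ s, ∀ j, (Xᵀ * V⁻¹ * M) j i = 0 := by
  have hVu : IsUnit V.det := hV.det_pos.ne'.isUnit
  have hVt : Vᵀ = V := by simpa [conjTranspose_eq_transpose_of_trivial] using hV.isHermitian.eq
  have hG : IsUnit (Xᵀ * V⁻¹ * X).det := (posDef_transpose_mul_inv_mul hX hV).det_pos.ne'.isUnit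
  have hPt := residual_transpose hVt hP
  have hPX := residual_mul_design hG hP
  have hXP : Xᵀ * P = 0 := by
    rw [← hPt, ← transpose_mul, hPX, transpose_zero]
  have hPVP : P * V * P = P := by
    rw [residual_mul_cov hVu hP, Matrix.sub_mul, Matrix.one_mul, Matrix.mul_assoc _ Xᵀ P, hXP,
      Matrix.mul_zero, sub_zero]
  obtain ⟨T, s, hT, hD, hs⟩ := exists_mul_transpose_eq_and_diagonal hV hPt hPVP
  have hTu : IsUnit T.det := by
    have : IsUnit (T.det * Tᵀ.det) := by rwa [← det_mul, hT]
    exact isUnit_of_mul_isUnit_left this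
  have hTtu : IsUnit Tᵀ.det := by rwa [det_transpose]
  have hVT : V⁻¹ * T = (Tᵀ)⁻¹ := by
    rw [← hT, Matrix.mul_inv_rev, Matrix.mul_assoc, Matrix.nonsing_inv_mul _ hTu, Matrix.mul_one]
  have hzero : Xᵀ * V⁻¹ * T * diagonal (fun i => if i ∈ s then (1 : ℝ) else 0) = 0 := by
    rw [← hD, Matrix.mul_assoc Xᵀ, hVT, Matrix.mul_assoc Tᵀ, Matrix.mul_assoc Xᵀ,
      ← Matrix.mul_assoc _ Tᵀ, Matrix.nonsing_inv_mul _ hTtu, Matrix.one_mul, ← Matrix.mul_assoc,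
      hXP, Matrix.zero_mul]
  refine ⟨√σ2 • T, s, ?_, ?_, ?_, ?_, ?_⟩
  · rw [det_smul]
    exact mul_ne_zero (pow_ne_zero _ (Real.sqrt_pos.2 hσ).ne') hTu.ne_zero
  · rw [transpose_smul, smul_mul_smul_comm, hT, Real.mul_self_sqrt hσ.le]
  · rw [hs, trace_residual_mul_cov hVu hG hP]
  · intro β w
    have hM : (T.mulVec w) ⬝ᵥ P.mulVec (T.mulVec w) = ∑ i ∈ s, w i ^ 2 := by
      rw [dotProduct_comm, dotProduct_mulVec, ← mulVec_transpose, mulVec_mulVec, mulVec_mulVec,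
        hD]
      simp [dotProduct, mulVec_diagonal, ite_mul, sq]
    rw [mulVec_add, mulVec_mulVec, hPX, zero_mulVec, zero_add, add_dotProduct,
      dotProduct_comm (X.mulVec β), dotProduct_mulVec _ X, ← mulVec_transpose, mulVec_mulVec, hXP,
      zero_mulVec, zero_dotProduct, zero_add, smul_mulVec, mulVec_smul, smul_dotProduct,
      dotProduct_smul, hM, smul_eq_mul, smul_eq_mul, ← mul_assoc, Real.mul_self_sqrt hσ.le]
  · intro i hi j
    have h := congrFun (congrFun hzero j) i
    rw [mul_diagonal, if_pos hi, mul_one] at h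
    rw [Matrix.mul_smul, Matrix.smul_apply, h]
    simp

end Projection

theorem dotProduct_transpose_mul_mul_mulVec {m n : Type*} [Fintype m] [Fintype n]
    (C : Matrix m n ℝ) (K : Matrix m m ℝ) (y : n → ℝ) :
    y ⬝ᵥ (Cᵀ * K * C).mulVec y = C.mulVec y ⬝ᵥ K.mulVec (C.mulVec y) := by
  rw [Matrix.mul_assoc, ← mulVec_mulVec, dotProduct_mulVec, ← mulVec_transpose,
    transpose_transpose, ← mulVec_mulVec]

theorem mulVec_add_mulVec_apply {l m n : Type*} [Fintype m] [Fintype n] (C : Matrix l m ℝ)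
    (M : Matrix m n ℝ) (b : m → ℝ) (w : n → ℝ) (j : l) :
    C.mulVec (b + M.mulVec w) j = C.mulVec b j + ∑ i, (C * M) j i * w i := by
  rw [mulVec_add, Pi.add_apply, mulVec_mulVec]
  rfl

/-- Proposition 1: with `σ̂² = yᵀPy/n`, the criterion
`IC_{π,1} = -2 log f_π(y|σ̂²) + 2n/(n-p-2)` is an unbiased estimator of the
information `I_{π,1}(ω) = E[-2 log f_π(ỹ|σ̂²)]`, where `y, ỹ` are independent
copies from `N_n(Xβ, σ²V)`; equivalently
`E[ỹᵀAỹ/σ̂²] - E[yᵀAy/σ̂²] = 2n/(n-p-2)`. -/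
theorem stmt_8 (n p : ℕ) (hnp : p + 2 < n) (X : Matrix (Fin n) (Fin p) ℝ)
    (hX : X.rank = p) (β : Fin p → ℝ) (V : Matrix (Fin n) (Fin n) ℝ)
    (hV : V.PosDef) (W : Matrix (Fin p) (Fin p) ℝ) (hW : W.PosDef)
    (σ2 : ℝ) (hσ : 0 < σ2)
    (P A : Matrix (Fin n) (Fin n) ℝ)
    (hP : P = V⁻¹ - V⁻¹ * X * (Xᵀ * V⁻¹ * X)⁻¹ * Xᵀ * V⁻¹)
    (hA : A = V⁻¹ - V⁻¹ * X * (Xᵀ * V⁻¹ * X + W⁻¹)⁻¹ * Xᵀ * V⁻¹) :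
    ((∫ y : Fin n → ℝ,
        (neg2logMarg n p X V W A (y ⬝ᵥ P.mulVec y / n) y + 2 * n / ((n : ℝ) - p - 2))
          * gaussPdf (X.mulVec β) (σ2 • V) y)
      = ∫ y : Fin n → ℝ,
          (∫ ytil : Fin n → ℝ,
            neg2logMarg n p X V W A (y ⬝ᵥ P.mulVec y / n) ytil
              * gaussPdf (X.mulVec β) (σ2 • V) ytil)
            * gaussPdf (X.mulVec β) (σ2 • V) y) ∧
    ((∫ y : Fin n → ℝ,
        (∫ ytil : Fin n → ℝ,
          ((ytil ⬝ᵥ A.mulVec ytil) / (y ⬝ᵥ P.mulVec y / n))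
            * gaussPdf (X.mulVec β) (σ2 • V) ytil)
          * gaussPdf (X.mulVec β) (σ2 • V) y)
      - (∫ y : Fin n → ℝ,
          ((y ⬝ᵥ A.mulVec y) / (y ⬝ᵥ P.mulVec y / n))
            * gaussPdf (X.mulVec β) (σ2 • V) y)
      = 2 * n / ((n : ℝ) - p - 2)) := by
  have hn : (0 : ℝ) < n := by exact_mod_cast (by omega : 0 < n)
  have hnp' : (2 : ℝ) < n - p := by
    have : (p : ℝ) + 2 < n := by exact_mod_cast hnp
    linarith
  obtain ⟨M, s, hMd, hMM, hs, hquad, hcol⟩ := exists_canonical_coordinates hX hV hσ hP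
  have hs2 : 2 < s.card := by
    have : (2 : ℝ) < s.card := hs ▸ hnp'
    exact_mod_cast this
  simp_rw [integral_mul_gaussPdf (X.mulVec β) hMd hMM]
  set γ : Measure (Fin n → ℝ) := Measure.pi fun _ => ProbabilityTheory.gaussianReal 0 1
  set K : Matrix (Fin p) (Fin p) ℝ := (Xᵀ * V⁻¹ * X)⁻¹ - (Xᵀ * V⁻¹ * X + W⁻¹)⁻¹ with hK
  set u : (Fin n → ℝ) → Fin p → ℝ := fun w => (Xᵀ * V⁻¹).mulVec (X.mulVec β + M.mulVec w)
  set q : (Fin n → ℝ) → ℝ := fun w => σ2 * ∑ i ∈ s, w i ^ 2 with hq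
  set r : (Fin n → ℝ) → ℝ := fun w => u w ⬝ᵥ K.mulVec (u w) with hr
  have hVt : (V⁻¹)ᵀ = V⁻¹ := by
    simpa [conjTranspose_eq_transpose_of_trivial] using hV.inv.isHermitian.eq
  have hPq : ∀ w, (X.mulVec β + M.mulVec w) ⬝ᵥ P.mulVec (X.mulVec β + M.mulVec w) = q w :=
    fun w => hquad β w
  have hAqr : ∀ w, (X.mulVec β + M.mulVec w) ⬝ᵥ A.mulVec (X.mulVec β + M.mulVec w) =
      q w + r w := by
    intro w
    have hAP : A = P + (Xᵀ * V⁻¹)ᵀ * K * (Xᵀ * V⁻¹) := by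
      rw [hA, hP, hK, transpose_mul, transpose_transpose, hVt]
      simp only [Matrix.mul_sub, Matrix.sub_mul, Matrix.mul_assoc]
      abel
    rw [hAP, add_mulVec, dotProduct_add, hPq, dotProduct_transpose_mul_mul_mulVec]
  have hpos : ∀ᵐ w ∂γ, 0 < q w := by
    filter_upwards [ae_sum_sq_pos (Finset.card_pos.1 (by omega : 0 < s.card))] with w hw
    exact mul_pos hσ hw
  have hqi : Integrable q γ := (integrable_sum_sq s).const_mul σ2
  have hqe : ∫ w, q w ∂γ = σ2 * (n - p) := by
    rw [hq, integral_const_mul, integral_sum_sq, hs]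
  have hqinv : Integrable (fun w => (q w)⁻¹) γ := by
    simp_rw [hq, mul_inv]
    exact (integrable_inv_sum_sq hs2).const_mul _
  have hqinve : ∫ w, (q w)⁻¹ ∂γ = σ2⁻¹ * ((n : ℝ) - p - 2)⁻¹ := by
    simp_rw [hq, mul_inv]
    rw [integral_const_mul, integral_inv_sum_sq hs2, hs]
  have hu_apply : ∀ w j, u w j =
      (Xᵀ * V⁻¹).mulVec (X.mulVec β) j + ∑ i, (Xᵀ * V⁻¹ * M) j i * w i :=
    fun w j => mulVec_add_mulVec_apply _ M _ w j
  have hri : Integrable r γ := by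
    refine integrable_dotProduct_mulVec_self K fun j => ?_
    simp_rw [hu_apply]
    exact memLp_two_affine_pi_gaussianReal _ _
  have hu_meas : Measurable u := by
    refine measurable_pi_iff.2 fun j => ?_
    simp_rw [hu_apply]
    fun_prop
  have hr_meas : Measurable r := by
    have h : ∀ j, Measurable fun w => u w j := fun j => (measurable_pi_apply j).comp hu_meas
    simp only [hr, dotProduct, mulVec]
    fun_prop
  have hind : ProbabilityTheory.IndepFun q r γ := by
    refine indepFun_of_dependsOn s (by fun_prop) hr_meas (fun w => ?_) fun w => ?_
    · simp only [hq]
      congr 1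
      exact Finset.sum_congr rfl fun i hi => by rw [if_pos hi]
    · have h : u w = u fun i => if i ∈ s then 0 else w i := by
        funext j
        rw [hu_apply, hu_apply]
        congr 1
        refine Finset.sum_congr rfl fun i _ => ?_
        split_ifs with hi
        · rw [hcol i hi j, zero_mul, zero_mul]
        · rfl
      simp only [hr, ← h]
  obtain ⟨hint, hval⟩ := integral_add_div_of_indepFun (n : ℝ) hpos hqinv hri hind
  have hinner : ∀ c : ℝ, ∫ w, (q w + r w) / (c / n) ∂γ =
      (σ2 * (n - p) + ∫ w, r w ∂γ) * n * c⁻¹ := by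
    intro c
    rw [integral_div, integral_add hqi hri, hqe, div_div_eq_mul_div, div_eq_mul_inv]
  have hgap : (σ2 * (n - p) + ∫ w, r w ∂γ) * n * (σ2⁻¹ * ((n : ℝ) - p - 2)⁻¹) =
      n * (1 + (∫ w, r w ∂γ) * (σ2⁻¹ * ((n : ℝ) - p - 2)⁻¹)) + 2 * n / ((n : ℝ) - p - 2) := by
    have : (n : ℝ) - p - 2 ≠ 0 := by linarith
    field_simp
    ring
  rw [hqinve] at hval
  simp_rw [neg2logMarg, hPq, hAqr]
  constructor
  · have hlog : Integrable (fun w => n * Real.log (2 * π * (q w / n))) γ := by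
      refine (integrable_log_of_integrable_inv (q := fun w => 2 * π * (q w / n)) ?_ ?_ ?_).const_mul _
      · filter_upwards [hpos] with w hw
        positivity
      · exact (hqi.div_const _).const_mul _
      · refine (hqinv.const_mul ((2 * π)⁻¹ * n)).congr (ae_of_all _ fun w => ?_)
        simp only [mul_inv, inv_div]
        ring
    have hsum : ∀ c : ℝ, Integrable (fun w => (q w + r w) / (c / n)) γ := fun c =>
      (hqi.add hri).div_const _
    have hbase : Integrable (fun w => n * Real.log (2 * π * (q w / n)) + Real.log V.det
        + Real.log (W * Xᵀ * V⁻¹ * X + 1).det) γ :=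
      (hlog.add (integrable_const _)).add (integrable_const _)
    have hfull : Integrable (fun w => n * Real.log (2 * π * (q w / n)) + Real.log V.det
        + Real.log (W * Xᵀ * V⁻¹ * X + 1).det + (q w + r w) / (q w / n)) γ :=
      hbase.add hint
    have hinner' : ∀ w, ∫ w', (n * Real.log (2 * π * (q w / n)) + Real.log V.det
        + Real.log (W * Xᵀ * V⁻¹ * X + 1).det + (q w' + r w') / (q w / n)) ∂γ =
        n * Real.log (2 * π * (q w / n)) + Real.log V.det
          + Real.log (W * Xᵀ * V⁻¹ * X + 1).det
          + (σ2 * (n - p) + ∫ w, r w ∂γ) * n * (q w)⁻¹ := by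
      intro w
      rw [integral_add (integrable_const _) (hsum _), hinner]
      simp
    simp_rw [hinner']
    rw [integral_add hfull (integrable_const _), integral_add hbase hint, hval,
      integral_add hbase (hqinv.const_mul _), integral_const_mul, hqinve, hgap]
    simp [add_assoc]
  · simp_rw [hinner]
    rw [integral_const_mul, hqinve, hval, hgap]
    ring
end
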